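/- arXiv:2408.06638 — 2 statements merged into one kernel-verified Lean document; each statement's English description precedes it below -/
import Mathlib

section
/- Let 𝒵 and 𝒴 be standard Borel spaces and let μ_s and μ_t be probability measures on 𝒵 × 𝒴 (representation coordinate first, label coordinate second), with representation marginals P_Z^s, P_Z^t (first-coordinate pushforwards) and label marginals P_Y^s, P_Y^t (second-coordinate pushforwards). Suppose d_JS(P_Y^s, P_Y^t) ≥ d_JS(P_Z^s, P_Z^t). Then for every measurable predictor h : 𝒵 → 𝒴, μ_s({(z, y) : h(z) ≠ y}) + μ_t({(z, y) : h(z) ≠ y}) ≥ (1/2) · (√(d_JS(P_Y^s, P_Y^t)) − √(d_JS(P_Z^s, P_Z^t)))². -/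
open MeasureTheory

/-- The Kullback–Leibler divergence `KL(P ‖ Q) = ∫ log (dP/dQ) dP` (as a real number; in the
Jensen–Shannon divergence below it is only evaluated at pairs `P ≪ M` for which this integral
is the genuine, finite KL divergence). -/
noncomputable def klDiv {α : Type*} [MeasurableSpace α] (P Q : Measure α) : ℝ :=
  ∫ x, llr P Q x ∂P

/-- The Jensen–Shannon divergence
`d_JS(P, Q) = (1/2)·KL(P ‖ M) + (1/2)·KL(Q ‖ M)` where `M = (1/2)(P + Q)`. -/
noncomputable def jsDiv {α : Type*} [MeasurableSpace α] (P Q : Measure α) : ℝ :=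
  (1 / 2) * klDiv P ((2 : ENNReal)⁻¹ • (P + Q)) + (1 / 2) * klDiv Q ((2 : ENNReal)⁻¹ • (P + Q))


/-- pointwise Jensen–Shannon function -/
noncomputable def jsL (p q : ℝ) : ℝ :=
  p * Real.log p + q * Real.log q - (p + q) * Real.log ((p + q) / 2)

lemma lint_exp_Ioi {c : ℝ} (hc : 0 < c) :
    ∫⁻ t in Set.Ioi (0:ℝ), ENNReal.ofReal (Real.exp (-(c * t))) = ENNReal.ofReal c⁻¹ := by
  have h1 := integral_exp_mul_Ioi (a := -c) (by linarith) 0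
  have h2 := integrableOn_exp_mul_Ioi (a := -c) (by linarith) 0
  simp only [neg_mul] at h1 h2
  rw [← ofReal_integral_eq_lintegral_ofReal h2 (Filter.Eventually.of_forall fun _ => (Real.exp_pos _).le), h1]
  simp

lemma lint_exp_Ioc {a b t : ℝ} (hab : a ≤ b) (ht : 0 < t) :
    ∫⁻ s in Set.Ioc a b, ENNReal.ofReal (Real.exp (-(s * t)))
      = ENNReal.ofReal ((Real.exp (-(a * t)) - Real.exp (-(b * t))) / t) := by
  have hc : Continuous (fun s : ℝ => Real.exp (-(s * t))) := by fun_prop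
  rw [← ofReal_integral_eq_lintegral_ofReal (hc.integrableOn_Ioc)
    (Filter.Eventually.of_forall fun _ => (Real.exp_pos _).le),
    ← intervalIntegral.integral_of_le hab]
  congr 1
  rw [intervalIntegral.integral_eq_sub_of_hasDerivAt (f := fun s => - Real.exp (-(s * t)) / t)
    _ (hc.intervalIntegrable _ _)]
  · ring
  · intro x _
    have h1 : HasDerivAt (fun s : ℝ => -(s * t)) (-(1 * t)) x := ((hasDerivAt_id x).mul_const t).neg
    have h2 := h1.exp.neg.div_const t
    have h3 : -(Real.exp (-(x * t)) * -(1 * t)) / t = Real.exp (-(x * t)) := by field_simp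
    rw [h3] at h2
    exact h2

lemma lint_inv_Ioc {a b s : ℝ} (hab : a ≤ b) (hs : 0 < s + a) :
    ∫⁻ u in Set.Ioc a b, ENNReal.ofReal (s + u)⁻¹
      = ENNReal.ofReal (Real.log (s + b) - Real.log (s + a)) := by
  have hi : IntervalIntegrable (fun u : ℝ => (s + u)⁻¹) volume a b := by
    apply ContinuousOn.intervalIntegrable
    rw [Set.uIcc_of_le hab]
    apply ContinuousOn.inv₀ (by fun_prop)
    intro x hx; have := hx.1; linarith
  rw [← ofReal_integral_eq_lintegral_ofReal ((intervalIntegrable_iff_integrableOn_Ioc_of_le hab).1 hi),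
    ← intervalIntegral.integral_of_le hab]
  · congr 1
    rw [intervalIntegral.integral_comp_add_left (fun x => x⁻¹),
      integral_inv_of_pos hs (by linarith), Real.log_div (by linarith) (by linarith)]
  · filter_upwards [ae_restrict_mem measurableSet_Ioc] with x hx
    have := hx.1
    simp only [Pi.zero_apply]
    apply inv_nonneg.2; linarith

lemma lint_log_Ioc {a b : ℝ} (ha : 0 ≤ a) (hab : a ≤ b) :
    ∫⁻ s in Set.Ioc a b, ENNReal.ofReal (Real.log (s + b) - Real.log (s + a))
      = ENNReal.ofReal (jsL (2 * a) (2 * b)) := by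
  have i1 : IntervalIntegrable (fun s : ℝ => Real.log (s + b)) volume a b :=
    by
    simpa using (IntervalIntegrable.comp_add_right
      (intervalIntegral.intervalIntegrable_log' (a := a + b) (b := b + b)) b)
  have i2 : IntervalIntegrable (fun s : ℝ => Real.log (s + a)) volume a b :=
    by
    simpa using (IntervalIntegrable.comp_add_right
      (intervalIntegral.intervalIntegrable_log' (a := a + a) (b := b + a)) a)
  rw [← ofReal_integral_eq_lintegral_ofReal
      ((intervalIntegrable_iff_integrableOn_Ioc_of_le hab).1 (i1.sub i2)),
    ← intervalIntegral.integral_of_le hab, intervalIntegral.integral_sub i1 i2,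
    intervalIntegral.integral_comp_add_right (fun x => Real.log x),
    intervalIntegral.integral_comp_add_right (fun x => Real.log x), integral_log, integral_log]
  · congr 1
    unfold jsL
    rw [show (2 * a + 2 * b) / 2 = a + b by ring, show b + a = a + b by ring, ← two_mul, ← two_mul]
    ring
  · filter_upwards [ae_restrict_mem measurableSet_Ioc] with x hx
    have := hx.1
    simp only [Pi.zero_apply]
    have : Real.log (x + a) ≤ Real.log (x + b) := Real.log_le_log (by linarith) (by linarith)
    linarith

/-- embedding difference -/
noncomputable def embD (p q t : ℝ) : ENNReal :=
  ENNReal.ofReal (|Real.exp (-(p / 2 * t)) - Real.exp (-(q / 2 * t))| / t)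

lemma jsL_repr_le {p q : ℝ} (hp : 0 ≤ p) (hpq : p ≤ q) :
    ∫⁻ t in Set.Ioi (0:ℝ), embD p q t ^ (2:ℝ) = ENNReal.ofReal (jsL p q) := by
  set a := p / 2 with ha
  set b := q / 2 with hb
  have ha0 : 0 ≤ a := by positivity
  have hab : a ≤ b := by rw [ha, hb]; linarith
  have e1 : ∀ t ∈ Set.Ioi (0:ℝ), embD p q t ^ (2:ℝ) =
      ∫⁻ s in Set.Ioc a b, ∫⁻ u in Set.Ioc a b,
        ENNReal.ofReal (Real.exp (-((s + u) * t))) := by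
    intro t ht
    have ht : 0 < t := ht
    have : ∀ s u : ℝ, ENNReal.ofReal (Real.exp (-((s + u) * t))) =
      ENNReal.ofReal (Real.exp (-(s * t))) * ENNReal.ofReal (Real.exp (-(u * t))) := by
      intro s u
      rw [← ENNReal.ofReal_mul (Real.exp_pos _).le, ← Real.exp_add]
      congr 2; ring
    simp_rw [this]
    rw [lintegral_lintegral_mul (by fun_prop) (by fun_prop), lint_exp_Ioc hab ht, embD,
      abs_of_nonneg, ← ha, ← hb]
    · rw [← sq]; norm_cast
    · rw [sub_nonneg]; apply Real.exp_le_exp.2; nlinarith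
  rw [setLIntegral_congr_fun measurableSet_Ioi e1, lintegral_lintegral_swap (by fun_prop)]
  have e2 : ∀ s ∈ Set.Ioc a b, ∫⁻ t in Set.Ioi (0:ℝ), ∫⁻ u in Set.Ioc a b,
        ENNReal.ofReal (Real.exp (-((s + u) * t))) =
      ENNReal.ofReal (Real.log (s + b) - Real.log (s + a)) := by
    intro s hs
    have := hs.1
    rw [lintegral_lintegral_swap (by fun_prop), ← lint_inv_Ioc hab (by linarith)]
    apply setLIntegral_congr_fun measurableSet_Ioc
    intro u hu
    have := hu.1
    exact lint_exp_Ioi (by linarith)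
  rw [setLIntegral_congr_fun measurableSet_Ioc e2, lint_log_Ioc ha0 hab]
  congr 2 <;> [rw [ha]; rw [hb]] <;> ring

lemma jsL_comm (p q : ℝ) : jsL p q = jsL q p := by unfold jsL; rw [add_comm p q]; ring

lemma jsL_repr {p q : ℝ} (hp : 0 ≤ p) (hq : 0 ≤ q) :
    ∫⁻ t in Set.Ioi (0:ℝ), embD p q t ^ (2:ℝ) = ENNReal.ofReal (jsL p q) := by
  rcases le_total p q with h | h
  · exact jsL_repr_le hp h
  · rw [jsL_comm, ← jsL_repr_le hq h]; simp only [embD, abs_sub_comm]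

lemma mink {α : Type*} [MeasurableSpace α] {μ : Measure α} {f g k : α → ENNReal}
    (hg : AEMeasurable g μ) (hk : AEMeasurable k μ) (hf : ∀ᵐ x ∂μ, f x ≤ g x + k x) :
    (∫⁻ x, f x ^ (2:ℝ) ∂μ) ^ (1 / (2:ℝ)) ≤
      (∫⁻ x, g x ^ (2:ℝ) ∂μ) ^ (1 / (2:ℝ)) + (∫⁻ x, k x ^ (2:ℝ) ∂μ) ^ (1 / (2:ℝ)) := by
  refine le_trans ?_ (ENNReal.lintegral_Lp_add_le hg hk (by norm_num))
  gcongr ?_ ^ _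
  apply lintegral_mono_ae
  filter_upwards [hf] with x hx
  exact ENNReal.rpow_le_rpow hx (by norm_num)

lemma jsL_triangle {p q r : ℝ} (hp : 0 ≤ p) (hq : 0 ≤ q) (hr : 0 ≤ r) :
    (ENNReal.ofReal (jsL p q)) ^ (1 / (2:ℝ)) ≤
      (ENNReal.ofReal (jsL p r)) ^ (1 / (2:ℝ)) + (ENNReal.ofReal (jsL r q)) ^ (1 / (2:ℝ)) := by
  rw [← jsL_repr hp hq, ← jsL_repr hp hr, ← jsL_repr hr hq]
  apply mink
  · unfold embD; fun_prop
  · unfold embD; fun_prop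
  · filter_upwards [ae_restrict_mem measurableSet_Ioi] with t ht
    have ht : 0 < t := ht
    unfold embD
    rw [← ENNReal.ofReal_add (by positivity) (by positivity), ← add_div]
    apply ENNReal.ofReal_le_ofReal
    gcongr
    exact abs_sub_le _ _ _

/-- one-sided pointwise term -/
noncomputable def jsK (p q : ℝ) : ℝ := p * Real.log p - p * Real.log ((p + q) / 2)

lemma jsL_eq (p q : ℝ) : jsL p q = jsK p q + jsK q p := by
  unfold jsL jsK; rw [add_comm q p]; ring

lemma jsK_le {p q : ℝ} (hp : 0 ≤ p) (hq : 0 ≤ q) : jsK p q * (p + q) ≤ p * (p - q) := by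
  rcases hp.eq_or_lt with rfl | hp
  · simp [jsK]
  have h1 : 0 < (p + q) / 2 := by positivity
  have h2 := Real.log_le_sub_one_of_pos (div_pos hp h1)
  rw [Real.log_div hp.ne' h1.ne'] at h2
  have h3 : p / ((p + q) / 2) - 1 = (p - q) / (p + q) := by field_simp; ring
  rw [h3, le_div_iff₀ (by linarith)] at h2
  unfold jsK
  nlinarith

lemma jsK_ge {p q : ℝ} (hp : 0 ≤ p) (hq : 0 ≤ q) : (p - q) / 2 ≤ jsK p q := by
  rcases hp.eq_or_lt with rfl | hp
  · simp [jsK]; linarith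
  have h1 : 0 < (p + q) / 2 := by positivity
  have h2 := Real.log_le_sub_one_of_pos (div_pos h1 hp)
  rw [Real.log_div h1.ne' hp.ne'] at h2
  have h3 : p * ((p + q) / 2 / p - 1) = (q - p) / 2 := by field_simp; ring
  have := mul_le_mul_of_nonneg_left h2 hp.le
  rw [h3] at this
  unfold jsK
  linarith

lemma jsK_abs_le {p q : ℝ} (hp : 0 ≤ p) (hq : 0 ≤ q) : |jsK p q| ≤ p + q := by
  rw [abs_le]
  constructor
  · have := jsK_ge hp hq; linarith
  · have := jsK_le hp hq
    rcases (add_nonneg hp hq).eq_or_lt with h | h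
    · have : p = 0 := by linarith
      have : q = 0 := by linarith
      subst_vars; simp [jsK]
    · by_contra! hc
      nlinarith [mul_nonneg hp hq, mul_pos h h, sq_nonneg q]

lemma jsL_nonneg {p q : ℝ} (hp : 0 ≤ p) (hq : 0 ≤ q) : 0 ≤ jsL p q := by
  rw [jsL_eq]
  have := jsK_ge hp hq
  have := jsK_ge hq hp
  linarith

lemma jsL_le {p q : ℝ} (hp : 0 ≤ p) (hq : 0 ≤ q) : jsL p q ≤ |p - q| := by
  have h1 := jsK_le hp hq
  have h2 := jsK_le hq hp
  have h3 : jsL p q * (p + q) ≤ (p - q) ^ 2 := by rw [jsL_eq]; nlinarith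
  rcases (add_nonneg hp hq).eq_or_lt with h | h
  · have : p = 0 := by linarith
    have : q = 0 := by linarith
    subst_vars; simp [jsL]
  · have h4 : (p - q) ^ 2 ≤ |p - q| * (p + q) := by
      rw [← sq_abs, sq]
      gcongr
      rw [abs_le]; constructor <;> linarith
    exact le_of_mul_le_mul_right (h3.trans h4) h

section
variable {α : Type*} [MeasurableSpace α]

lemma measurable_jsK {f g : α → ℝ} (hf : Measurable f) (hg : Measurable g) :
    Measurable (fun x => jsK (f x) (g x)) := by unfold jsK; fun_prop

lemma measurable_jsL {f g : α → ℝ} (hf : Measurable f) (hg : Measurable g) :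
    Measurable (fun x => jsL (f x) (g x)) := by unfold jsL; fun_prop

lemma integrable_jsK (P Q ν : Measure α) [IsFiniteMeasure P] [IsFiniteMeasure Q] :
    Integrable (fun x => jsK (P.rnDeriv ν x).toReal (Q.rnDeriv ν x).toReal) ν := by
  refine Integrable.mono' ((Measure.integrable_toReal_rnDeriv (μ := P) (ν := ν)).add
    (Measure.integrable_toReal_rnDeriv (μ := Q) (ν := ν))) ?_ ?_
  · exact (measurable_jsK (by fun_prop) (by fun_prop)).aestronglyMeasurable
  · exact Filter.Eventually.of_forall fun x =>
      jsK_abs_le ENNReal.toReal_nonneg ENNReal.toReal_nonneg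

lemma ac_mid (P Q : Measure α) : P ≪ (2 : ENNReal)⁻¹ • (P + Q) := by
  intro s hs
  simpa using (by simpa using hs : P s = 0 ∧ Q s = 0).1

lemma llr_mid (P Q ν : Measure α) [IsFiniteMeasure P] [IsFiniteMeasure Q] [IsFiniteMeasure ν] :
    (fun x => (P.rnDeriv ν x).toReal * llr P ((2 : ENNReal)⁻¹ • (P + Q)) x) =ᵐ[ν]
      fun x => jsK (P.rnDeriv ν x).toReal (Q.rnDeriv ν x).toReal := by
  have : IsFiniteMeasure ((2 : ENNReal)⁻¹ • (P + Q)) := Measure.smul_finite _ (by simp)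
  filter_upwards [Measure.rnDeriv_mul_rnDeriv (κ := ν) (ac_mid P Q), Measure.rnDeriv_add P Q ν,
    Measure.rnDeriv_smul_left_of_ne_top (P + Q) ν (r := (2 : ENNReal)⁻¹) (by simp),
    P.rnDeriv_lt_top ν, Q.rnDeriv_lt_top ν] with x h1 h2 h3 h4 h5
  have h6 : (P.rnDeriv ν x).toReal = (P.rnDeriv ((2 : ENNReal)⁻¹ • (P + Q)) x).toReal *
      (((P.rnDeriv ν x).toReal + (Q.rnDeriv ν x).toReal) / 2) := by
    simp only [Pi.mul_apply, h3, h2, Pi.smul_apply, Pi.add_apply, smul_eq_mul] at h1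
    have h7 := congrArg ENNReal.toReal h1
    simp only [ENNReal.toReal_mul, ENNReal.toReal_add h4.ne h5.ne, ENNReal.toReal_inv,
      ENNReal.toReal_ofNat] at h7
    linarith
  unfold jsK
  rw [llr]
  generalize (P.rnDeriv ((2 : ENNReal)⁻¹ • (P + Q)) x).toReal = r at *
  have hq0 : 0 ≤ (Q.rnDeriv ν x).toReal := ENNReal.toReal_nonneg
  have hp0 : 0 ≤ (P.rnDeriv ν x).toReal := ENNReal.toReal_nonneg
  generalize (P.rnDeriv ν x).toReal = p at *
  generalize (Q.rnDeriv ν x).toReal = q at *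
  rcases hp0.eq_or_lt with rfl | hp
  · simp
  have hm : (p + q) / 2 ≠ 0 := by positivity
  have hr : r ≠ 0 := by rintro rfl; simp at h6; linarith
  have : Real.log p = Real.log r + Real.log ((p + q) / 2) := by
    rw [← Real.log_mul hr hm, ← h6]
  rw [this]; ring

lemma integrable_llr_mid (P Q : Measure α) [IsFiniteMeasure P] [IsFiniteMeasure Q] :
    Integrable (llr P ((2 : ENNReal)⁻¹ • (P + Q))) P := by
  have hac : P ≪ P + Q := Measure.AbsolutelyContinuous.rfl.add_right Q
  rw [← integrable_toReal_rnDeriv_mul_iff hac]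
  exact (integrable_jsK P Q (P + Q)).congr (llr_mid P Q (P + Q)).symm

lemma klDiv_mid (P Q ν : Measure α) [IsFiniteMeasure P] [IsFiniteMeasure Q] [IsFiniteMeasure ν]
    (hP : P ≪ ν) : klDiv P ((2 : ENNReal)⁻¹ • (P + Q)) =
      ∫ x, jsK (P.rnDeriv ν x).toReal (Q.rnDeriv ν x).toReal ∂ν := by
  rw [klDiv, ← integral_rnDeriv_smul hP]
  exact integral_congr_ae (llr_mid P Q ν)

lemma integrable_jsL (P Q ν : Measure α) [IsFiniteMeasure P] [IsFiniteMeasure Q] :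
    Integrable (fun x => jsL (P.rnDeriv ν x).toReal (Q.rnDeriv ν x).toReal) ν := by
  simp_rw [jsL_eq]
  exact (integrable_jsK P Q ν).add (integrable_jsK Q P ν)

lemma jsDiv_eq (P Q ν : Measure α) [IsFiniteMeasure P] [IsFiniteMeasure Q] [IsFiniteMeasure ν]
    (hP : P ≪ ν) (hQ : Q ≪ ν) : jsDiv P Q =
      (1 / 2) * ∫ x, jsL (P.rnDeriv ν x).toReal (Q.rnDeriv ν x).toReal ∂ν := by
  simp_rw [jsL_eq]
  rw [integral_add (integrable_jsK P Q ν) (integrable_jsK Q P ν), jsDiv, klDiv_mid P Q ν hP,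
    add_comm P Q, klDiv_mid Q P ν hQ]
  ring

lemma jsDiv_comm (P Q : Measure α) : jsDiv P Q = jsDiv Q P := by
  unfold jsDiv; rw [add_comm P Q]; ring

lemma jsDiv_triangle (P Q R : Measure α) [IsFiniteMeasure P] [IsFiniteMeasure Q]
    [IsFiniteMeasure R] : √(jsDiv P Q) ≤ √(jsDiv P R) + √(jsDiv R Q) := by
  set ν := P + Q + R with hν
  have hP : P ≪ ν := (Measure.AbsolutelyContinuous.rfl.add_right Q).add_right R
  have hQ : Q ≪ ν := by rw [hν, add_comm P Q]; exact (Measure.AbsolutelyContinuous.rfl.add_right P).add_right R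
  have hR : R ≪ ν := by rw [hν, add_comm]; exact Measure.AbsolutelyContinuous.rfl.add_right _
  have key : ∀ A B : Measure α, IsFiniteMeasure A → IsFiniteMeasure B → A ≪ ν → B ≪ ν →
      ENNReal.ofReal (√(2 * jsDiv A B)) =
      (∫⁻ x, ((ENNReal.ofReal (jsL (A.rnDeriv ν x).toReal (B.rnDeriv ν x).toReal)) ^ (1 / (2:ℝ)))
        ^ (2:ℝ) ∂ν) ^ (1 / (2:ℝ)) := by
    intro A B _ _ hA hB
    simp_rw [← ENNReal.rpow_mul]
    rw [show (1 / (2:ℝ)) * 2 = 1 by norm_num]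
    simp_rw [ENNReal.rpow_one]
    have hn : 0 ≤ ∫ x, jsL (A.rnDeriv ν x).toReal (B.rnDeriv ν x).toReal ∂ν :=
      integral_nonneg fun x => jsL_nonneg ENNReal.toReal_nonneg ENNReal.toReal_nonneg
    rw [← ofReal_integral_eq_lintegral_ofReal (integrable_jsL A B ν)
      (Filter.Eventually.of_forall fun x => jsL_nonneg ENNReal.toReal_nonneg ENNReal.toReal_nonneg),
      jsDiv_eq A B ν hA hB, ENNReal.ofReal_rpow_of_nonneg hn (by norm_num), Real.sqrt_eq_rpow]
    congr 2
    ring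
  have hm : ∀ A B : Measure α, AEMeasurable (fun x => (ENNReal.ofReal
      (jsL (A.rnDeriv ν x).toReal (B.rnDeriv ν x).toReal)) ^ (1 / (2:ℝ))) ν := by
    intro A B
    have hmm := measurable_jsL (f := fun x => (A.rnDeriv ν x).toReal)
      (g := fun x => (B.rnDeriv ν x).toReal) (by fun_prop) (by fun_prop)
    exact (hmm.ennreal_ofReal.pow_const _).aemeasurable
  have := mink (hm P R) (hm R Q) (Filter.Eventually.of_forall fun x =>
    jsL_triangle (p := (P.rnDeriv ν x).toReal) (q := (Q.rnDeriv ν x).toReal)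
      ENNReal.toReal_nonneg ENNReal.toReal_nonneg ENNReal.toReal_nonneg)
  rw [← key P Q inferInstance inferInstance hP hQ, ← key P R inferInstance inferInstance hP hR,
    ← key R Q inferInstance inferInstance hR hQ, ← ENNReal.ofReal_add (by positivity) (by positivity),
    ENNReal.ofReal_le_ofReal_iff (by positivity)] at this
  simp only [Real.sqrt_mul (show (0:ℝ) ≤ 2 by norm_num), ← mul_add] at this
  exact le_of_mul_le_mul_left this (by positivity)

lemma klDiv_eq_toReal (P Q : Measure α) [IsProbabilityMeasure P] [IsProbabilityMeasure Q] :
    klDiv P ((2 : ENNReal)⁻¹ • (P + Q)) =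
      (InformationTheory.klDiv P ((2 : ENNReal)⁻¹ • (P + Q))).toReal := by
  have : IsFiniteMeasure ((2 : ENNReal)⁻¹ • (P + Q)) := Measure.smul_finite _ (by simp)
  rw [InformationTheory.toReal_klDiv_of_measure_eq (ac_mid P Q), klDiv]
  simp [ENNReal.inv_two_add_inv_two]

lemma klDiv_mid_map_le {β : Type*} [MeasurableSpace β] (P Q : Measure α) [IsProbabilityMeasure P]
    [IsProbabilityMeasure Q] {g : α → β} (hg : Measurable g) :
    klDiv (P.map g) ((2 : ENNReal)⁻¹ • (P.map g + Q.map g)) ≤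
      klDiv P ((2 : ENNReal)⁻¹ • (P + Q)) := by
  have : IsFiniteMeasure ((2 : ENNReal)⁻¹ • (P + Q)) := Measure.smul_finite _ (by simp)
  have := Measure.isProbabilityMeasure_map (μ := P) hg.aemeasurable
  have := Measure.isProbabilityMeasure_map (μ := Q) hg.aemeasurable
  rw [klDiv_eq_toReal, klDiv_eq_toReal, ← Measure.map_add _ _ hg, ← Measure.map_smul]
  apply ENNReal.toReal_mono
  · exact InformationTheory.klDiv_ne_top (ac_mid P Q) (integrable_llr_mid P Q)
  · exact InformationTheory.klDiv_map_le _ _ hg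

lemma jsDiv_map_le {β : Type*} [MeasurableSpace β] (P Q : Measure α) [IsProbabilityMeasure P]
    [IsProbabilityMeasure Q] {g : α → β} (hg : Measurable g) :
    jsDiv (P.map g) (Q.map g) ≤ jsDiv P Q := by
  have h1 := klDiv_mid_map_le P Q hg
  have h2 := klDiv_mid_map_le Q P hg
  unfold jsDiv
  rw [add_comm (Q.map g), add_comm Q] at h2
  linarith

lemma jsDiv_le_of_forall (P Q : Measure α) [IsFiniteMeasure P] [IsFiniteMeasure Q] (c : ℝ)
    (h1 : ∀ A, MeasurableSet A → P.real A - Q.real A ≤ c)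
    (h2 : ∀ A, MeasurableSet A → Q.real A - P.real A ≤ c) : jsDiv P Q ≤ c := by
  set ν := P + Q with hν
  have hP : P ≪ ν := Measure.AbsolutelyContinuous.rfl.add_right Q
  have hQ : Q ≪ ν := by rw [hν, add_comm P Q]; exact Measure.AbsolutelyContinuous.rfl.add_right P
  rw [jsDiv_eq P Q ν hP hQ]
  have iP := Measure.integrable_toReal_rnDeriv (μ := P) (ν := ν)
  have iQ := Measure.integrable_toReal_rnDeriv (μ := Q) (ν := ν)
  set A := {x | (Q.rnDeriv ν x).toReal ≤ (P.rnDeriv ν x).toReal} with hA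
  have mA : MeasurableSet A := measurableSet_le (by fun_prop) (by fun_prop)
  have hle : ∫ x, jsL (P.rnDeriv ν x).toReal (Q.rnDeriv ν x).toReal ∂ν ≤
      ∫ x, |(P.rnDeriv ν x).toReal - (Q.rnDeriv ν x).toReal| ∂ν :=
    integral_mono (integrable_jsL P Q ν) (iP.sub iQ).abs fun x =>
      jsL_le ENNReal.toReal_nonneg ENNReal.toReal_nonneg
  have iabs : Integrable (fun x => |(P.rnDeriv ν x).toReal - (Q.rnDeriv ν x).toReal|) ν :=
    (iP.sub iQ).abs
  rw [← integral_add_compl mA iabs] at hle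
  have e1 : ∫ x in A, |(P.rnDeriv ν x).toReal - (Q.rnDeriv ν x).toReal| ∂ν
      = P.real A - Q.real A := by
    rw [← Measure.setIntegral_toReal_rnDeriv hP, ← Measure.setIntegral_toReal_rnDeriv hQ,
      ← integral_sub iP.integrableOn iQ.integrableOn]
    refine setIntegral_congr_fun mA fun x hx => abs_of_nonneg (sub_nonneg.2 hx)
  have e2 : ∫ x in Aᶜ, |(P.rnDeriv ν x).toReal - (Q.rnDeriv ν x).toReal| ∂ν
      = Q.real Aᶜ - P.real Aᶜ := by
    rw [← Measure.setIntegral_toReal_rnDeriv hP, ← Measure.setIntegral_toReal_rnDeriv hQ,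
      ← integral_sub iQ.integrableOn iP.integrableOn]
    refine setIntegral_congr_fun mA.compl fun x hx => ?_
    have : (P.rnDeriv ν x).toReal < (Q.rnDeriv ν x).toReal := not_le.1 hx
    change |_| = _
    rw [abs_of_nonpos (by linarith)]; ring
  rw [e1, e2] at hle
  have := h1 A mA
  have := h2 _ mA.compl
  linarith

end

lemma jsDiv_maps_le {α β : Type*} [MeasurableSpace α] [MeasurableSpace β] (μ : Measure α)
    [IsFiniteMeasure μ] {f g : α → β} (hf : Measurable f) (hg : Measurable g) :
    jsDiv (μ.map f) (μ.map g) ≤ (μ {x | g x ≠ f x}).toReal := by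
  apply jsDiv_le_of_forall
  · intro A hA
    rw [map_measureReal_apply hf hA, map_measureReal_apply hg hA, sub_le_iff_le_add']
    refine le_trans (measureReal_mono ?_) (measureReal_union_le _ _)
    intro x hx
    by_cases h : g x = f x
    · left; simpa [h] using hx
    · right; exact h
  · intro A hA
    rw [map_measureReal_apply hf hA, map_measureReal_apply hg hA, sub_le_iff_le_add']
    refine le_trans (measureReal_mono ?_) (measureReal_union_le _ _)
    intro x hx
    by_cases h : g x = f x
    · left; simpa [h] using hx
    · right; exact h

/-- **Generalization lower bound (Theorem 1, Zhao et al.).**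
Let `μs`, `μt` be the source and target joint distributions on `Z × Y` (representation first,
label second), with representation marginals `μ.map Prod.fst` and label marginals
`μ.map Prod.snd`. If `d_JS(P_Y^s, P_Y^t) ≥ d_JS(P_Z^s, P_Z^t)`, then for every measurable
predictor `h : Z → Y`,
`ε_s(h) + ε_t(h) ≥ (1/2)·(√d_JS(P_Y^s, P_Y^t) − √d_JS(P_Z^s, P_Z^t))²`. -/
theorem generalization_lower_bound
    {Z Y : Type*} [MeasurableSpace Z] [MeasurableSpace Y]
    [StandardBorelSpace Z] [StandardBorelSpace Y]
    (μs μt : Measure (Z × Y)) [IsProbabilityMeasure μs] [IsProbabilityMeasure μt]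
    (hJS : jsDiv (μs.map Prod.snd) (μt.map Prod.snd)
        ≥ jsDiv (μs.map Prod.fst) (μt.map Prod.fst))
    (h : Z → Y) (hh : Measurable h) :
    (μs {p : Z × Y | h p.1 ≠ p.2}).toReal + (μt {p : Z × Y | h p.1 ≠ p.2}).toReal
      ≥ (1 / 2) * (Real.sqrt (jsDiv (μs.map Prod.snd) (μt.map Prod.snd))
          - Real.sqrt (jsDiv (μs.map Prod.fst) (μt.map Prod.fst))) ^ 2 := by
  have mg : Measurable (fun p : Z × Y => h p.1) := hh.comp measurable_fst
  have a := jsDiv_maps_le μs measurable_snd mg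
  have b := jsDiv_maps_le μt measurable_snd mg
  set Ps := μs.map (fun p : Z × Y => h p.1) with hPs
  set Pt := μt.map (fun p : Z × Y => h p.1) with hPt
  have : IsProbabilityMeasure (μs.map Prod.fst) :=
    Measure.isProbabilityMeasure_map measurable_fst.aemeasurable
  have : IsProbabilityMeasure (μt.map Prod.fst) :=
    Measure.isProbabilityMeasure_map measurable_fst.aemeasurable
  have e1 : Ps = (μs.map Prod.fst).map h := (Measure.map_map hh measurable_fst).symm
  have e2 : Pt = (μt.map Prod.fst).map h := (Measure.map_map hh measurable_fst).symm
  have c : jsDiv Ps Pt ≤ jsDiv (μs.map Prod.fst) (μt.map Prod.fst) := by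
    rw [e1, e2]; exact jsDiv_map_le _ _ hh
  have t1 := jsDiv_triangle (μs.map Prod.snd) (μt.map Prod.snd) Ps
  have t2 := jsDiv_triangle Ps (μt.map Prod.snd) Pt
  rw [jsDiv_comm Pt] at t2
  have sa := Real.sqrt_le_sqrt a
  have sb := Real.sqrt_le_sqrt b
  have sc := Real.sqrt_le_sqrt c
  have sj := Real.sqrt_le_sqrt hJS
  have qa := Real.sq_sqrt (ENNReal.toReal_nonneg (a := μs {p : Z × Y | h p.1 ≠ p.2}))
  have qb := Real.sq_sqrt (ENNReal.toReal_nonneg (a := μt {p : Z × Y | h p.1 ≠ p.2}))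
  set u := √(μs {p : Z × Y | h p.1 ≠ p.2}).toReal
  set v := √(μt {p : Z × Y | h p.1 ≠ p.2}).toReal
  have hd : √(jsDiv (μs.map Prod.snd) (μt.map Prod.snd))
          - √(jsDiv (μs.map Prod.fst) (μt.map Prod.fst)) ≤ u + v := by linarith
  have hd2 := pow_le_pow_left₀ (sub_nonneg.2 sj) hd 2
  nlinarith [sq_nonneg (u - v)]
end

section
/- Let P, Q, R be probability measures on a measurable space. Then √(d_JS(P, R)) ≤ √(d_JS(P, Q)) + √(d_JS(Q, R)); that is, the square root of the Jensen–Shannon divergence satisfies the triangle inequality. -/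
open MeasureTheory

namespace JSAux

/-- Twice the pointwise Jensen–Shannon integrand. -/
noncomputable def A (p q : ℝ) : ℝ :=
  p * Real.log p + q * Real.log q - (p + q) * Real.log (p + q) + (p + q) * Real.log 2

/-- The partial derivative of `A` in the first variable, `log (2x/(x+q))`. -/
noncomputable def ell (x q : ℝ) : ℝ := Real.log x - Real.log (x + q) + Real.log 2

lemma A_comm (p q : ℝ) : A p q = A q p := by
  unfold A; rw [add_comm q p]; ring

lemma A_self (p : ℝ) (hp : 0 < p) : A p p = 0 := by
  unfold A
  have : p + p = 2 * p := by ring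
  rw [this, Real.log_mul (by norm_num) hp.ne']; ring

lemma A_eq (p q : ℝ) : A p q = p * ell p q + q * ell q p := by
  unfold A ell; rw [add_comm q p]; ring

lemma ell_eq {x q : ℝ} (hx : 0 < x) (hq : 0 < q) : ell x q = Real.log (2 * x / (x + q)) := by
  unfold ell
  rw [Real.log_div (by positivity) (by positivity), Real.log_mul (by norm_num) hx.ne']; ring

lemma ell_lower {x q : ℝ} (hx : 0 < x) (hq : 0 < q) : (x - q) / (2 * x) ≤ ell x q := by
  rw [ell_eq hx hq]
  have h := Real.one_sub_inv_le_log_of_pos (x := 2 * x / (x + q)) (by positivity)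
  refine le_trans (le_of_eq ?_) h
  field_simp; ring

lemma ell_lower_strict {x q : ℝ} (hx : 0 < x) (hq : 0 < q) (hne : x ≠ q) :
    (x - q) / 2 < x * ell x q := by
  rw [ell_eq hx hq]
  have hy : 0 < (x + q) / (2 * x) := by positivity
  have hy1 : (x + q) / (2 * x) ≠ 1 := by
    intro h
    rw [div_eq_one_iff_eq (by positivity)] at h
    apply hne; linarith
  have h := Real.log_lt_sub_one_of_pos hy hy1
  have e : Real.log (2 * x / (x + q)) = - Real.log ((x + q) / (2 * x)) := by
    rw [← Real.log_inv, inv_div]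
  rw [e]
  have h2 := mul_lt_mul_of_pos_left h hx
  have e2 : x * ((x + q) / (2 * x) - 1) = (q - x) / 2 := by field_simp; ring
  linarith

lemma ell_nonneg {x q : ℝ} (hx : 0 < x) (hq : 0 < q) (h : q ≤ x) : 0 ≤ ell x q := by
  refine le_trans ?_ (ell_lower hx hq)
  apply div_nonneg <;> linarith

lemma ell_nonpos {x q : ℝ} (hx : 0 < x) (hq : 0 < q) (h : x ≤ q) : ell x q ≤ 0 := by
  rw [ell_eq hx hq]
  apply Real.log_nonpos (by positivity)
  rw [div_le_one (by positivity)]; linarith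

lemma A_pos {p q : ℝ} (hp : 0 < p) (hq : 0 < q) (h : p ≠ q) : 0 < A p q := by
  rw [A_eq]
  have h1 := ell_lower_strict hp hq h
  have h2 := ell_lower_strict hq hp h.symm
  linarith

lemma A_nonneg_pos {p q : ℝ} (hp : 0 < p) (hq : 0 < q) : 0 ≤ A p q := by
  by_cases h : p = q
  · subst h; rw [A_self p hp]
  · exact (A_pos hp hq h).le

lemma A_cont : Continuous (fun z : ℝ × ℝ => A z.1 z.2) := by
  have h : Continuous (fun x : ℝ => x * Real.log x) := Real.continuous_mul_log
  unfold A
  have h1 := h.comp (continuous_fst (X := ℝ) (Y := ℝ))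
  have h2 := h.comp (continuous_snd (X := ℝ) (Y := ℝ))
  have h3 := h.comp ((continuous_fst (X := ℝ) (Y := ℝ)).add continuous_snd)
  exact ((h1.add h2).sub h3).add ((continuous_fst.add continuous_snd).mul continuous_const)

lemma A_cont_left (q : ℝ) : Continuous (fun x => A x q) :=
  A_cont.comp (continuous_id.prodMk continuous_const)

lemma hasDeriv_ell {x q : ℝ} (hx : 0 < x) (hq : 0 < q) :
    HasDerivAt (fun x => ell x q) (1 / x - 1 / (x + q)) x := by
  have h1 := (hasDerivAt_id x).log hx.ne'
  have h2 := ((hasDerivAt_id x).add_const q).log (by simp; positivity)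
  exact (h1.sub h2).add_const _

lemma hasDeriv_A {x q : ℝ} (hx : 0 < x) (hq : 0 < q) :
    HasDerivAt (fun x => A x q) (ell x q) x := by
  have hxq : x + q ≠ 0 := by positivity
  have h1 := Real.hasDerivAt_mul_log hx.ne'
  have h2 := (Real.hasDerivAt_mul_log hxq).comp_add_const x q
  have h3 := ((hasDerivAt_id x).add_const q).mul_const (Real.log 2)
  have h := ((h1.add_const (q * Real.log q)).sub h2).add h3
  refine HasDerivAt.congr_deriv (f := fun x => A x q) h ?_
  unfold ell; ring

lemma le_help {f f' : ℝ → ℝ} {a b : ℝ} (hab : a ≤ b) (hc : ContinuousOn f (Set.Icc a b))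
    (hd : ∀ x ∈ Set.Ioo a b, HasDerivAt f (f' x) x) (hn : ∀ x ∈ Set.Ioo a b, 0 ≤ f' x) :
    f a ≤ f b := by
  have := monotoneOn_of_deriv_nonneg (convex_Icc a b) hc
    (fun x hx => by
      rw [interior_Icc] at hx
      exact (hd x hx).differentiableAt.differentiableWithinAt)
    (fun x hx => by
      rw [interior_Icc] at hx
      rw [(hd x hx).deriv]; exact hn x hx)
  exact this (Set.left_mem_Icc.2 hab) (Set.right_mem_Icc.2 hab) hab

lemma ge_help {f f' : ℝ → ℝ} {a b : ℝ} (hab : a ≤ b) (hc : ContinuousOn f (Set.Icc a b))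
    (hd : ∀ x ∈ Set.Ioo a b, HasDerivAt f (f' x) x) (hn : ∀ x ∈ Set.Ioo a b, f' x ≤ 0) :
    f b ≤ f a := by
  have := le_help (f := fun x => - f x) (f' := fun x => - f' x) hab hc.neg
    (fun x hx => (hd x hx).neg) (fun x hx => by have := hn x hx; linarith)
  linarith

lemma A_mono {a b q : ℝ} (hq : 0 < q) (h1 : q ≤ a) (h2 : a ≤ b) : A a q ≤ A b q :=
  le_help (f := fun x => A x q) (f' := fun x => ell x q) h2 (A_cont_left q).continuousOn
    (fun x hx => hasDeriv_A (by linarith [hx.1]) hq)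
    (fun x hx => ell_nonneg (by linarith [hx.1]) hq (by linarith [hx.1]))

lemma A_anti {a b q : ℝ} (ha : 0 < a) (h1 : b ≤ q) (h2 : a ≤ b) : A b q ≤ A a q :=
  have hq : 0 < q := by linarith
  ge_help (f := fun x => A x q) (f' := fun x => ell x q) h2 (A_cont_left q).continuousOn
    (fun x hx => hasDeriv_A (by linarith [hx.1]) hq)
    (fun x hx => ell_nonpos (by linarith [hx.1]) hq (by linarith [hx.2]))

lemma ell_self {q : ℝ} (hq : 0 < q) : ell q q = 0 :=
  le_antisymm (ell_nonpos hq hq le_rfl) (ell_nonneg hq hq le_rfl)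

lemma hasDeriv_D {x q : ℝ} (hx : 0 < x) (hq : 0 < q) :
    HasDerivAt (fun x => (x + q) ^ 2 * ell x q ^ 2 - 4 * q * A x q)
      (2 * ell x q * ((x + q) * ell x q + q * (q - x) / x)) x := by
  have h1 := ((hasDerivAt_id x).add_const q).pow 2
  have h2 := (hasDeriv_ell hx hq).pow 2
  have h := (h1.mul h2).sub ((hasDeriv_A hx hq).const_mul (4 * q))
  refine HasDerivAt.congr_deriv (f := fun x => (x + q) ^ 2 * ell x q ^ 2 - 4 * q * A x q) h ?_
  simp
  field_simp
  ring

lemma D_bracket {x q : ℝ} (hx : 0 < x) (hq : 0 < q) :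
    0 ≤ (x + q) * ell x q + q * (q - x) / x := by
  have h := mul_le_mul_of_nonneg_left (ell_lower hx hq) (by positivity : 0 ≤ x + q)
  have e : (x + q) * ((x - q) / (2 * x)) + q * (q - x) / x = (x - q) ^ 2 / (2 * x) := by
    field_simp; ring
  have : 0 ≤ (x - q) ^ 2 / (2 * x) := by positivity
  linarith

lemma A_bound {x q : ℝ} (hx : 0 < x) (hq : 0 < q) :
    4 * q * A x q ≤ (x + q) ^ 2 * ell x q ^ 2 := by
  have h0 : (q + q) ^ 2 * ell q q ^ 2 - 4 * q * A q q = 0 := by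
    rw [ell_self hq, A_self q hq]; ring
  rcases le_total x q with h | h
  · have := ge_help (f := fun x => (x + q) ^ 2 * ell x q ^ 2 - 4 * q * A x q) h
      (fun y hy => (hasDeriv_D (by linarith [hy.1]) hq).continuousAt.continuousWithinAt)
      (fun y hy => hasDeriv_D (by linarith [hy.1]) hq)
      (fun y hy => by
        have hy0 : 0 < y := by linarith [hy.1]
        exact mul_nonpos_of_nonpos_of_nonneg
          (by linarith [ell_nonpos hy0 hq hy.2.le]) (D_bracket hy0 hq))
    linarith
  · have := le_help (f := fun x => (x + q) ^ 2 * ell x q ^ 2 - 4 * q * A x q) h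
      (fun y hy => (hasDeriv_D (by linarith [hy.1]) hq).continuousAt.continuousWithinAt)
      (fun y hy => hasDeriv_D (by linarith [hy.1]) hq)
      (fun y hy => by
        have hy0 : 0 < y := by linarith [hy.1]
        exact mul_nonneg
          (by linarith [ell_nonneg hy0 hq hy.1.le]) (D_bracket hy0 hq))
    linarith

lemma step3 {p q r : ℝ} (hp : 0 < p) (hpq : p ≤ q) (hqr : q ≤ r) :
    2 * (√(A p q) * √(A r q)) ≤ (p + r) * (-ell p q) * ell r q := by
  have hq : 0 < q := by linarith
  have hr : 0 < r := by linarith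
  have l1 := ell_nonpos hp hq hpq
  have l2 := ell_nonneg hr hq hqr
  have b1 := A_bound hp hq
  have b2 := A_bound hr hq
  have n1 := A_nonneg_pos hp hq
  have n2 := A_nonneg_pos hr hq
  have hN : 0 ≤ -ell p q * ell r q := mul_nonneg (by linarith) l2
  have key : √(A p q) * √(A r q) ≤ (p + r) / 2 * (-ell p q * ell r q) := by
    rw [← Real.sqrt_mul n1]
    apply Real.sqrt_le_iff.2
    refine ⟨by positivity, ?_⟩
    have hm := mul_le_mul b1 b2 (by positivity) (by positivity)
    have hc : (p + q) * (r + q) ≤ 2 * q * (p + r) := by nlinarith [mul_nonneg (sub_nonneg.2 hpq) (sub_nonneg.2 hqr)]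
    have hc2 : ((p + q) * (r + q)) ^ 2 ≤ (2 * q * (p + r)) ^ 2 := by gcongr
    have hc3 := mul_le_mul_of_nonneg_right hc2 (sq_nonneg (-ell p q * ell r q))
    have hfin : (16 * q ^ 2) * (A p q * A r q) ≤
        (16 * q ^ 2) * ((p + r) / 2 * (-ell p q * ell r q)) ^ 2 := by
      calc _ = 4 * q * A p q * (4 * q * A r q) := by ring
        _ ≤ _ := hm
        _ = ((p + q) * (r + q)) ^ 2 * (-ell p q * ell r q) ^ 2 := by ring
        _ ≤ _ := hc3
        _ = _ := by ring
    exact le_of_mul_le_mul_left hfin (by positivity)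
  linarith

lemma step4 {p q r : ℝ} (hp : 0 < p) (hpq : p ≤ q) (hqr : q < r) :
    (Real.log (q + r) - Real.log (p + r)) * √(A r q) ≤ √(A p q) * ell r q := by
  have hq : 0 < q := by linarith
  have hr : 0 < r := by linarith
  have := ge_help (a := p) (b := q)
    (f := fun x => √(A x q) * ell r q - (Real.log (q + r) - Real.log (x + r)) * √(A r q))
    (f' := fun x => ell x q / (2 * √(A x q)) * ell r q - (0 - 1 / (x + r)) * √(A r q)) hpq
    (by
      apply ContinuousOn.sub
      · exact ((A_cont_left q).sqrt.mul continuous_const).continuousOn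
      · apply ContinuousOn.mul _ continuousOn_const
        apply continuousOn_const.sub
        apply ContinuousOn.log (by fun_prop)
        intro x hx
        have := hx.1
        linarith)
    (fun x hx => by
      have hx0 : 0 < x := by linarith [hx.1]
      have h1 := ((hasDeriv_A hx0 hq).sqrt (A_pos hx0 hq hx.2.ne).ne').mul_const (ell r q)
      have h2 := ((hasDerivAt_id x).add_const r).log (by simp; positivity)
      exact h1.sub (((hasDerivAt_const x (Real.log (q + r))).sub h2).mul_const _))
    (fun x hx => by
      have hx0 : 0 < x := by linarith [hx.1]
      have hs : 0 < √(A x q) := Real.sqrt_pos.2 (A_pos hx0 hq hx.2.ne)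
      have h3 := step3 hx0 hx.2.le hqr.le
      have hxr : 0 < x + r := by linarith
      have e : ell x q / (2 * √(A x q)) * ell r q - (0 - 1 / (x + r)) * √(A r q)
          = (2 * (√(A x q) * √(A r q)) - (x + r) * (-ell x q) * ell r q)
            / (2 * √(A x q) * (x + r)) := by
        field_simp; ring
      rw [e]
      exact div_nonpos_of_nonpos_of_nonneg (by linarith) (by positivity))
  simp only [A_self q hq] at this
  simp at this
  linarith

lemma step5 {p q r : ℝ} (hp : 0 < p) (hpq : p ≤ q) (hqr : q ≤ r) :
    A r p - A p q - A r q ≤ 2 * (√(A p q) * √(A r q)) := by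
  have hq : 0 < q := by linarith
  have := le_help (a := q) (b := r)
    (f := fun x => 2 * (√(A p q) * √(A x q)) - (A x p - A p q - A x q))
    (f' := fun x => 2 * (√(A p q) * (ell x q / (2 * √(A x q)))) - (ell x p - ell x q)) hqr
    (by
      have h1 := A_cont_left q
      have h2 := A_cont_left p
      exact ((continuous_const.mul (continuous_const.mul h1.sqrt)).sub
        ((h2.sub continuous_const).sub h1)).continuousOn)
    (fun x hx => by
      have hx0 : 0 < x := by linarith [hx.1]
      have h1 := ((hasDeriv_A hx0 hq).sqrt (A_pos hx0 hq hx.1.ne').ne')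
      exact ((h1.const_mul (√(A p q))).const_mul 2).sub
        (((hasDeriv_A hx0 hp).sub_const _).sub (hasDeriv_A hx0 hq)))
    (fun x hx => by
      have hx0 : 0 < x := by linarith [hx.1]
      have hs : 0 < √(A x q) := Real.sqrt_pos.2 (A_pos hx0 hq hx.1.ne')
      have h4 := step4 hp hpq hx.1
      have e : 2 * (√(A p q) * (ell x q / (2 * √(A x q)))) - (ell x p - ell x q)
        = (√(A p q) * ell x q - (Real.log (q + x) - Real.log (p + x)) * √(A x q)) / √(A x q) := by
        have : ell x p - ell x q = Real.log (q + x) - Real.log (p + x) := by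
          unfold ell; rw [add_comm q, add_comm p]; ring
        rw [this]
        field_simp
      rw [e]
      exact div_nonneg (by linarith) hs.le)
  simp only [A_self q hq, A_comm q p] at this
  simp at this
  linarith

lemma tri_le {p q r : ℝ} (hp : 0 < p) (hq : 0 < q) (hpr : p ≤ r) :
    √(A p r) ≤ √(A p q) + √(A q r) := by
  have hr : 0 < r := by linarith
  rcases le_total q p with h | h
  · have := Real.sqrt_le_sqrt (A_anti hq hpr h)
    linarith [Real.sqrt_nonneg (A p q)]
  rcases le_total r q with h' | h'
  · have := Real.sqrt_le_sqrt (A_mono hp hpr h')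
    rw [A_comm r, A_comm q] at this
    linarith [Real.sqrt_nonneg (A q r)]
  · apply Real.sqrt_le_iff.2
    refine ⟨by positivity, ?_⟩
    have h5 := step5 hp h h'
    rw [A_comm q r, A_comm p r]
    have e1 := Real.sq_sqrt (A_nonneg_pos hp hq)
    have e2 := Real.sq_sqrt (A_nonneg_pos hr hq)
    nlinarith

lemma tri_pos {p q r : ℝ} (hp : 0 < p) (hq : 0 < q) (hr : 0 < r) :
    √(A p r) ≤ √(A p q) + √(A q r) := by
  rcases le_total p r with h | h
  · exact tri_le hp hq h
  · have := tri_le hr hq h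
    rw [A_comm r p, A_comm r q, A_comm q p] at this
    linarith

lemma tri {p q r : ℝ} (hp : 0 ≤ p) (hq : 0 ≤ q) (hr : 0 ≤ r) :
    √(A p r) ≤ √(A p q) + √(A q r) := by
  have hc : ∀ a b : ℝ, Filter.Tendsto (fun e : ℝ => √(A (a + e) (b + e)))
      (nhdsWithin 0 (Set.Ioi 0)) (nhds √(A a b)) := by
    intro a b
    have h : Continuous (fun e : ℝ => √(A (a + e) (b + e))) :=
      (A_cont.comp ((continuous_const.add continuous_id).prodMk
        (continuous_const.add continuous_id))).sqrt
    have := (h.tendsto 0).mono_left (nhdsWithin_le_nhds (s := Set.Ioi 0))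
    simpa using this
  refine le_of_tendsto_of_tendsto (hc p r) ((hc p q).add (hc q r)) ?_
  filter_upwards [self_mem_nhdsWithin] with e he
  have he : 0 < e := he
  exact tri_pos (by linarith) (by linarith) (by linarith)

lemma A_nonneg {p q : ℝ} (hp : 0 ≤ p) (hq : 0 ≤ q) : 0 ≤ A p q := by
  have h : Continuous (fun e : ℝ => A (p + e) (q + e)) :=
    (A_cont.comp ((continuous_const.add continuous_id).prodMk
        (continuous_const.add continuous_id)))
  have h2 := (h.tendsto 0).mono_left (nhdsWithin_le_nhds (s := Set.Ioi 0))
  simp only [add_zero] at h2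
  refine ge_of_tendsto h2 ?_
  filter_upwards [self_mem_nhdsWithin] with e he
  have he : 0 < e := he
  exact A_nonneg_pos (by linarith) (by linarith)

lemma ell_abs {p q : ℝ} (hp : 0 ≤ p) (hq : 0 ≤ q) : |p * ell p q| ≤ p + q := by
  rcases hp.eq_or_lt with rfl | hp
  · simpa using hq
  have hlow : (p - q) / 2 ≤ p * ell p q := by
    rcases hq.eq_or_lt with rfl | hq
    · unfold ell
      simp only [add_zero, sub_self, zero_add, sub_zero]
      nlinarith [Real.log_two_gt_d9]
    have := mul_le_mul_of_nonneg_left (ell_lower hp hq) hp.le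
    refine le_trans (le_of_eq ?_) this
    field_simp
  have hup : ell p q ≤ 1 := by
    unfold ell
    have := Real.log_le_log hp (by linarith : p ≤ p + q)
    linarith [Real.log_two_lt_d9]
  rw [abs_le]
  constructor <;> nlinarith

variable {α : Type*} [MeasurableSpace α]

lemma kl_eq (P Q S : Measure α) [IsFiniteMeasure P] [IsFiniteMeasure Q]
    [IsFiniteMeasure S] (hP : P ≪ S) (hQ : Q ≪ S) :
    klDiv P ((2 : ENNReal)⁻¹ • (P + Q)) =
      ∫ x, (P.rnDeriv S x).toReal * ell (P.rnDeriv S x).toReal (Q.rnDeriv S x).toReal ∂S := by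
  unfold klDiv
  set M := (2 : ENNReal)⁻¹ • (P + Q) with hM
  have hfin : IsFiniteMeasure M := Measure.smul_finite _ (by simp)
  have hPM : P ≪ M := by
    refine Measure.AbsolutelyContinuous.mk fun s _ h => ?_
    simp [hM] at h
    exact h.1
  rw [← integral_rnDeriv_smul hP]
  apply integral_congr_ae
  have h1 := Measure.rnDeriv_mul_rnDeriv (κ := S) hPM
  have h2 := Measure.rnDeriv_smul_left_of_ne_top (P + Q) S (r := (2 : ENNReal)⁻¹) (by simp)
  have h3 := Measure.rnDeriv_add P Q S
  have hfP := P.rnDeriv_lt_top S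
  have hfQ := Q.rnDeriv_lt_top S
  filter_upwards [h1, h2, h3, hfP, hfQ] with x h1 h2 h3 h4 h5
  simp only [Pi.mul_apply, Pi.smul_apply, Pi.add_apply, smul_eq_mul, llr] at *
  rw [h2, h3] at h1
  have h1' := congrArg ENNReal.toReal h1
  rw [ENNReal.toReal_mul, ENNReal.toReal_mul, ENNReal.toReal_add h4.ne h5.ne] at h1'
  simp only [ENNReal.toReal_inv, ENNReal.toReal_ofNat] at h1'
  set p := (P.rnDeriv S x).toReal
  set q := (Q.rnDeriv S x).toReal
  set a := (P.rnDeriv M x).toReal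
  have hp : 0 ≤ p := ENNReal.toReal_nonneg
  have hq : 0 ≤ q := ENNReal.toReal_nonneg
  rcases hp.eq_or_lt with h | hp
  · rw [← h]; simp
  congr 1
  have ha : a = 2 * p / (p + q) := by
    field_simp; linarith
  rw [ha]
  unfold ell
  rw [Real.log_div (by positivity) (by positivity), Real.log_mul (by norm_num) hp.ne']; ring

lemma meas_aux {p q : α → ℝ} (hp : Measurable p) (hq : Measurable q) :
    Measurable (fun x => p x * ell (p x) (q x)) := by
  unfold ell; fun_prop

lemma int_aux (S : Measure α) {p q : α → ℝ} (hp : Measurable p) (hq : Measurable q)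
    (hp0 : ∀ x, 0 ≤ p x) (hq0 : ∀ x, 0 ≤ q x) (hpi : Integrable p S) (hqi : Integrable q S) :
    Integrable (fun x => p x * ell (p x) (q x)) S :=
  (hpi.add hqi).mono' (meas_aux hp hq).aestronglyMeasurable
    (Filter.Eventually.of_forall fun x => ell_abs (hp0 x) (hq0 x))

lemma js_eq (P Q S : Measure α) [IsFiniteMeasure P] [IsFiniteMeasure Q]
    [IsFiniteMeasure S] (hP : P ≪ S) (hQ : Q ≪ S) :
    Integrable (fun x => A (P.rnDeriv S x).toReal (Q.rnDeriv S x).toReal) S ∧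
    jsDiv P Q = 1 / 2 * ∫ x, A (P.rnDeriv S x).toReal (Q.rnDeriv S x).toReal ∂S := by
  have i1 := int_aux S (P.measurable_rnDeriv S).ennreal_toReal (Q.measurable_rnDeriv S).ennreal_toReal
    (fun _ => ENNReal.toReal_nonneg) (fun _ => ENNReal.toReal_nonneg)
    Measure.integrable_toReal_rnDeriv Measure.integrable_toReal_rnDeriv
  have i2 := int_aux S (Q.measurable_rnDeriv S).ennreal_toReal (P.measurable_rnDeriv S).ennreal_toReal
    (fun _ => ENNReal.toReal_nonneg) (fun _ => ENNReal.toReal_nonneg)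
    Measure.integrable_toReal_rnDeriv Measure.integrable_toReal_rnDeriv
  simp only [A_eq]
  refine ⟨i1.add i2, ?_⟩
  rw [integral_add i1 i2]
  unfold jsDiv
  rw [kl_eq P Q S hP hQ, add_comm P Q, kl_eq Q P S hQ hP]
  ring

lemma minkowski (S : Measure α) {f g h : α → ℝ} (hf : Integrable f S) (hg : Integrable g S)
    (hh : Integrable h S) (f0 : ∀ x, 0 ≤ f x) (g0 : ∀ x, 0 ≤ g x) (h0 : ∀ x, 0 ≤ h x)
    (H : ∀ x, √(f x) ≤ √(g x) + √(h x)) :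
    √(∫ x, f x ∂S) ≤ √(∫ x, g x ∂S) + √(∫ x, h x ∂S) := by
  have mem : ∀ {k : α → ℝ}, Integrable k S → (∀ x, 0 ≤ k x) → MemLp (fun x => √(k x)) 2 S := by
    intro k hk k0
    rw [memLp_two_iff_integrable_sq (Real.continuous_sqrt.comp_aestronglyMeasurable hk.1)]
    simpa only [Real.sq_sqrt (k0 _)] using hk
  have mg := mem hg g0
  have mh := mem hh h0
  have himul : Integrable (fun x => √(g x) * √(h x)) S := mg.integrable_mul mh
  have cs := integral_mul_le_Lp_mul_Lq_of_nonneg (μ := S) Real.HolderConjugate.two_two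
    (f := fun x => √(g x)) (g := fun x => √(h x))
    (Filter.Eventually.of_forall fun x => Real.sqrt_nonneg _)
    (Filter.Eventually.of_forall fun x => Real.sqrt_nonneg _)
    (by simpa using mg) (by simpa using mh)
  simp only [Real.rpow_two, Real.sq_sqrt (g0 _), Real.sq_sqrt (h0 _), ← Real.sqrt_eq_rpow] at cs
  have hle : ∫ x, f x ∂S ≤ ∫ x, (g x + h x + 2 * (√(g x) * √(h x))) ∂S := by
    apply integral_mono hf ((hg.add hh).add (himul.const_mul 2))
    intro x
    have e1 := Real.sq_sqrt (f0 x)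
    have e2 := Real.sq_sqrt (g0 x)
    have e3 := Real.sq_sqrt (h0 x)
    have := pow_le_pow_left₀ (Real.sqrt_nonneg _) (H x) 2
    change f x ≤ g x + h x + 2 * (√(g x) * √(h x))
    nlinarith
  have hgh : Integrable (fun x => g x + h x) S := hg.add hh
  rw [integral_add hgh (himul.const_mul 2), integral_add hg hh,
    integral_const_mul] at hle
  apply Real.sqrt_le_iff.2
  refine ⟨by positivity, ?_⟩
  have e1 := Real.sq_sqrt (integral_nonneg (μ := S) g0)
  have e2 := Real.sq_sqrt (integral_nonneg (μ := S) h0)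
  nlinarith

end JSAux

/-- **Triangle inequality for the square root of the Jensen–Shannon divergence:**
for probability measures `P`, `Q`, `R`, `√d_JS(P, R) ≤ √d_JS(P, Q) + √d_JS(Q, R)`. -/
theorem sqrt_jsDiv_triangle {α : Type*} [MeasurableSpace α]
    (P Q R : Measure α) [IsProbabilityMeasure P] [IsProbabilityMeasure Q]
    [IsProbabilityMeasure R] :
    Real.sqrt (jsDiv P R) ≤ Real.sqrt (jsDiv P Q) + Real.sqrt (jsDiv Q R) := by
  set S : Measure α := P + Q + R with hS
  have hP : P ≪ S := by
    refine Measure.AbsolutelyContinuous.mk fun s _ h => ?_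
    simp [hS] at h
    exact h.1.1
  have hQ : Q ≪ S := by
    refine Measure.AbsolutelyContinuous.mk fun s _ h => ?_
    simp [hS] at h
    exact h.1.2
  have hR : R ≪ S := by
    refine Measure.AbsolutelyContinuous.mk fun s _ h => ?_
    simp [hS] at h
    exact h.2
  obtain ⟨i1, e1⟩ := JSAux.js_eq P R S hP hR
  obtain ⟨i2, e2⟩ := JSAux.js_eq P Q S hP hQ
  obtain ⟨i3, e3⟩ := JSAux.js_eq Q R S hQ hR
  have hm := JSAux.minkowski S i1 i2 i3
    (fun x => JSAux.A_nonneg ENNReal.toReal_nonneg ENNReal.toReal_nonneg)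
    (fun x => JSAux.A_nonneg ENNReal.toReal_nonneg ENNReal.toReal_nonneg)
    (fun x => JSAux.A_nonneg ENNReal.toReal_nonneg ENNReal.toReal_nonneg)
    (fun x => JSAux.tri ENNReal.toReal_nonneg ENNReal.toReal_nonneg ENNReal.toReal_nonneg)
  rw [e1, e2, e3, Real.sqrt_mul (by norm_num), Real.sqrt_mul (by norm_num),
    Real.sqrt_mul (by norm_num), ← mul_add]
  exact mul_le_mul_of_nonneg_left hm (Real.sqrt_nonneg _)
end
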